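/- arXiv:1410.3552 — 3 statements merged into one kernel-verified Lean document; each statement's English description precedes it below -/
import Mathlib

section
/- Let M, K₁, K₂, K₃ be skew-symmetric real 6×6 matrices, let λ be a real number, and let g : ℝ × ℝ³ → ℝ be a function. Suppose ξ, η : ℝ × ℝ³ → ℝ⁶ are differentiable and both satisfy the linear variational equation M ∂ₜu + K₁ ∂ₓu + K₂ ∂ᵧu + K₃ ∂_z u = λ g(t,x,y,z) u at every point. Then at every point (t,x,y,z) one has ∂ₜ⟨M ξ, η⟩ + ∂ₓ⟨K₁ ξ, η⟩ + ∂ᵧ⟨K₂ ξ, η⟩ + ∂_z⟨K₃ ξ, η⟩ = 0, where ⟨·,·⟩ denotes the Euclidean inner product on ℝ⁶. (This is the multi-symplectic conservation law d_t ω + ∂ₓκ₁ + ∂ᵧκ₂ + ∂_z κ₃ = 0 of the Hamiltonian PDE M du + K₁ uₓ dt + K₂ u_y dt + K₃ u_z dt = ∇S(u)∘dW with quadratic Hamiltonian S(u) = (λ/2)|u|², evaluated on a pair of solutions of its variational equation, with smooth coefficient g in place of the noise.) -/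
open Matrix

/-- A skew-symmetric matrix can be moved across the dot product at the cost of a sign. -/
theorem Matrix.mulVec_dotProduct_of_transpose_eq_neg {n R : Type*} [Fintype n] [CommRing R]
    {A : Matrix n n R} (hA : Aᵀ = -A) (v w : n → R) :
    A *ᵥ v ⬝ᵥ w = -(v ⬝ᵥ A *ᵥ w) := by
  rw [dotProduct_mulVec, ← mulVec_transpose, hA, neg_mulVec, neg_dotProduct, neg_neg]

/-- The Leibniz rule for the dot product of two differentiable vector fields. -/
theorem fderiv_dotProduct_apply {n E : Type*} [Fintype n] [NormedAddCommGroup E]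
    [NormedSpace ℝ E] {f h : E → n → ℝ} {p : E} (hf : DifferentiableAt ℝ f p)
    (hh : DifferentiableAt ℝ h p) (v : E) :
    fderiv ℝ (fun q => f q ⬝ᵥ h q) p v
      = fderiv ℝ f p v ⬝ᵥ h p + f p ⬝ᵥ fderiv ℝ h p v := by
  have key : HasFDerivAt (fun q => f q ⬝ᵥ h q) _ p :=
    HasFDerivAt.fun_sum fun i (_ : i ∈ Finset.univ) =>
      (hasFDerivAt_pi'.1 hf.hasFDerivAt i).mul (hasFDerivAt_pi'.1 hh.hasFDerivAt i)
  rw [key.fderiv]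
  simp [dotProduct, Finset.sum_add_distrib, mul_comm, add_comm]

/-- The directional derivative of the bilinear form of a skew-symmetric matrix, evaluated on two
differentiable vector fields. -/
theorem fderiv_mulVec_dotProduct_apply {n E : Type*} [Fintype n] [NormedAddCommGroup E]
    [NormedSpace ℝ E] {A : Matrix n n ℝ} (hA : Aᵀ = -A) {f h : E → n → ℝ} {p : E}
    (hf : DifferentiableAt ℝ f p) (hh : DifferentiableAt ℝ h p) (v : E) :
    fderiv ℝ (fun q => A *ᵥ f q ⬝ᵥ h q) p v
      = A *ᵥ fderiv ℝ f p v ⬝ᵥ h p - f p ⬝ᵥ A *ᵥ fderiv ℝ h p v := by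
  have key : HasFDerivAt (fun q => A *ᵥ f q) _ p :=
    A.mulVecLin.toContinuousLinearMap.hasFDerivAt.comp p hf.hasFDerivAt
  rw [fderiv_dotProduct_apply key.differentiableAt hh, key.fderiv,
    mulVec_dotProduct_of_transpose_eq_neg hA (f p), ← sub_eq_add_neg]
  rfl

/-- **Multi-symplectic conservation law (differential form).**
If `ξ, η : ℝ × ℝ³ → ℝ⁶` are differentiable and both satisfy the linear variational
equation `M ∂ₜu + K₁ ∂ₓu + K₂ ∂ᵧu + K₃ ∂_z u = λ g u` pointwise (with `M, Kᵢ`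
skew-symmetric), then `∂ₜ⟨Mξ,η⟩ + ∂ₓ⟨K₁ξ,η⟩ + ∂ᵧ⟨K₂ξ,η⟩ + ∂_z⟨K₃ξ,η⟩ = 0`. -/
theorem multisymplectic_conservation_law
    (M K₁ K₂ K₃ : Matrix (Fin 6) (Fin 6) ℝ)
    (hM : Mᵀ = -M) (hK₁ : K₁ᵀ = -K₁) (hK₂ : K₂ᵀ = -K₂) (hK₃ : K₃ᵀ = -K₃)
    (lam : ℝ) (g : ℝ × ℝ × ℝ × ℝ → ℝ)
    (ξ η : ℝ × ℝ × ℝ × ℝ → (Fin 6 → ℝ))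
    (hξ : Differentiable ℝ ξ) (hη : Differentiable ℝ η)
    (hξeq : ∀ p : ℝ × ℝ × ℝ × ℝ,
      M.mulVec (fderiv ℝ ξ p (1, 0, 0, 0)) + K₁.mulVec (fderiv ℝ ξ p (0, 1, 0, 0))
        + K₂.mulVec (fderiv ℝ ξ p (0, 0, 1, 0)) + K₃.mulVec (fderiv ℝ ξ p (0, 0, 0, 1))
        = (lam * g p) • ξ p)
    (hηeq : ∀ p : ℝ × ℝ × ℝ × ℝ,
      M.mulVec (fderiv ℝ η p (1, 0, 0, 0)) + K₁.mulVec (fderiv ℝ η p (0, 1, 0, 0))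
        + K₂.mulVec (fderiv ℝ η p (0, 0, 1, 0)) + K₃.mulVec (fderiv ℝ η p (0, 0, 0, 1))
        = (lam * g p) • η p) :
    ∀ p : ℝ × ℝ × ℝ × ℝ,
      fderiv ℝ (fun q => M.mulVec (ξ q) ⬝ᵥ η q) p (1, 0, 0, 0)
        + fderiv ℝ (fun q => K₁.mulVec (ξ q) ⬝ᵥ η q) p (0, 1, 0, 0)
        + fderiv ℝ (fun q => K₂.mulVec (ξ q) ⬝ᵥ η q) p (0, 0, 1, 0)
        + fderiv ℝ (fun q => K₃.mulVec (ξ q) ⬝ᵥ η q) p (0, 0, 0, 1) = 0 := by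
  intro p
  rw [fderiv_mulVec_dotProduct_apply hM (hξ p) (hη p),
    fderiv_mulVec_dotProduct_apply hK₁ (hξ p) (hη p),
    fderiv_mulVec_dotProduct_apply hK₂ (hξ p) (hη p),
    fderiv_mulVec_dotProduct_apply hK₃ (hξ p) (hη p)]
  have h₁ := congrArg (· ⬝ᵥ η p) (hξeq p)
  have h₂ := congrArg (ξ p ⬝ᵥ ·) (hηeq p)
  simp only [add_dotProduct, dotProduct_add, smul_dotProduct, dotProduct_smul] at h₁ h₂
  linarith
end

section
/- Let N be a positive integer, let A₁, A₂, A₃ be skew-symmetric real N×N matrices, let λ, Δt be real numbers, and let W ∈ ℝᴺ. Suppose the vectors E₁, E₂, E₃, H₁, H₂, H₃ ∈ ℝᴺ (values at time level n) and E₁', E₂', E₃', H₁', H₂', H₃' ∈ ℝᴺ (values at time level n+1) satisfy the full-discrete scheme, where for any pair x, x' we write x^{1/2} = (x + x')/2 and ∘ denotes componentwise multiplication of vectors in ℝᴺ: E₁' − E₁ = Δt(A₂H₃^{1/2} − A₃H₂^{1/2}) − λ H₁^{1/2}∘W, E₂' − E₂ = Δt(A₃H₁^{1/2} − A₁H₃^{1/2})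 − λ H₂^{1/2}∘W, E₃' − E₃ = Δt(A₁H₂^{1/2} − A₂H₁^{1/2}) − λ H₃^{1/2}∘W, H₁' − H₁ = Δt(A₃E₂^{1/2} − A₂E₃^{1/2}) + λ E₁^{1/2}∘W, H₂' − H₂ = Δt(A₁E₃^{1/2} − A₃E₁^{1/2}) + λ E₂^{1/2}∘W, H₃' − H₃ = Δt(A₂E₁^{1/2} − A₁E₂^{1/2}) + λ E₃^{1/2}∘W. Then ‖E₁'‖² + ‖E₂'‖² + ‖E₃'‖² + ‖H₁'‖² + ‖H₂'‖² + ‖H₃'‖² = ‖E₁‖² + ‖E₂‖² + ‖E₃‖² + ‖H₁‖² + ‖H₂‖² + ‖H₃‖², where ‖·‖ is the Euclidean norm on ℝᴺ. -/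
open Matrix

theorem dotProduct_mulVec_eq_neg_of_transpose_eq_neg {n R : Type*} [Fintype n] [CommRing R]
    {A : Matrix n n R} (hA : Aᵀ = -A) (u v : n → R) :
    u ⬝ᵥ A.mulVec v = -(v ⬝ᵥ A.mulVec u) := by
  rw [dotProduct_mulVec, ← mulVec_transpose, hA, neg_mulVec, neg_dotProduct, dotProduct_comm]

theorem dotProduct_mul_left_comm {n R : Type*} [Fintype n] [CommSemiring R] (u v w : n → R) :
    u ⬝ᵥ (v * w) = v ⬝ᵥ (u * w) :=
  Finset.sum_congr rfl fun i _ => mul_left_comm (u i) (v i) (w i)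

theorem dotProduct_self_eq_add_midpoint_dotProduct_sub {n : Type*} [Fintype n] (x y : n → ℝ) :
    y ⬝ᵥ y = x ⬝ᵥ x + 2 * (((1 / 2 : ℝ) • (x + y)) ⬝ᵥ (y - x)) := by
  simp only [smul_dotProduct, add_dotProduct, dotProduct_sub, smul_eq_mul, dotProduct_comm y x]
  ring

/-- **Discrete energy conservation law of the full-discrete scheme.**
With skew-symmetric differentiation matrices `A₁, A₂, A₃`, one step of the
stochastic multi-symplectic wavelet collocation scheme (implicit midpoint in
time, componentwise multiplication `*` by the noise vector `W`) preserves the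
squared Euclidean norm: `‖E^{n+1}‖² + ‖H^{n+1}‖² = ‖E^n‖² + ‖H^n‖²`. -/
theorem discrete_energy_conservation
    (N : ℕ) (hN : 0 < N)
    (A₁ A₂ A₃ : Matrix (Fin N) (Fin N) ℝ)
    (hA₁ : A₁ᵀ = -A₁) (hA₂ : A₂ᵀ = -A₂) (hA₃ : A₃ᵀ = -A₃)
    (lam Δt : ℝ) (W : Fin N → ℝ)
    (E₁ E₂ E₃ H₁ H₂ H₃ E₁' E₂' E₃' H₁' H₂' H₃' : Fin N → ℝ)
    (hE₁ : E₁' - E₁ = Δt • (A₂.mulVec ((1 / 2 : ℝ) • (H₃ + H₃'))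
        - A₃.mulVec ((1 / 2 : ℝ) • (H₂ + H₂')))
      - lam • (((1 / 2 : ℝ) • (H₁ + H₁')) * W))
    (hE₂ : E₂' - E₂ = Δt • (A₃.mulVec ((1 / 2 : ℝ) • (H₁ + H₁'))
        - A₁.mulVec ((1 / 2 : ℝ) • (H₃ + H₃')))
      - lam • (((1 / 2 : ℝ) • (H₂ + H₂')) * W))
    (hE₃ : E₃' - E₃ = Δt • (A₁.mulVec ((1 / 2 : ℝ) • (H₂ + H₂'))
        - A₂.mulVec ((1 / 2 : ℝ) • (H₁ + H₁')))
      - lam • (((1 / 2 : ℝ) • (H₃ + H₃')) * W))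
    (hH₁ : H₁' - H₁ = Δt • (A₃.mulVec ((1 / 2 : ℝ) • (E₂ + E₂'))
        - A₂.mulVec ((1 / 2 : ℝ) • (E₃ + E₃')))
      + lam • (((1 / 2 : ℝ) • (E₁ + E₁')) * W))
    (hH₂ : H₂' - H₂ = Δt • (A₁.mulVec ((1 / 2 : ℝ) • (E₃ + E₃'))
        - A₃.mulVec ((1 / 2 : ℝ) • (E₁ + E₁')))
      + lam • (((1 / 2 : ℝ) • (E₂ + E₂')) * W))
    (hH₃ : H₃' - H₃ = Δt • (A₂.mulVec ((1 / 2 : ℝ) • (E₁ + E₁'))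
        - A₁.mulVec ((1 / 2 : ℝ) • (E₂ + E₂')))
      + lam • (((1 / 2 : ℝ) • (E₃ + E₃')) * W)) :
    E₁' ⬝ᵥ E₁' + E₂' ⬝ᵥ E₂' + E₃' ⬝ᵥ E₃' + H₁' ⬝ᵥ H₁' + H₂' ⬝ᵥ H₂' + H₃' ⬝ᵥ H₃'
      = E₁ ⬝ᵥ E₁ + E₂ ⬝ᵥ E₂ + E₃ ⬝ᵥ E₃ + H₁ ⬝ᵥ H₁ + H₂ ⬝ᵥ H₂ + H₃ ⬝ᵥ H₃ := by
  rw [dotProduct_self_eq_add_midpoint_dotProduct_sub E₁ E₁',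
    dotProduct_self_eq_add_midpoint_dotProduct_sub E₂ E₂',
    dotProduct_self_eq_add_midpoint_dotProduct_sub E₃ E₃',
    dotProduct_self_eq_add_midpoint_dotProduct_sub H₁ H₁',
    dotProduct_self_eq_add_midpoint_dotProduct_sub H₂ H₂',
    dotProduct_self_eq_add_midpoint_dotProduct_sub H₃ H₃',
    hE₁, hE₂, hE₃, hH₁, hH₂, hH₃]
  generalize (1 / 2 : ℝ) • (E₁ + E₁') = e₁
  generalize (1 / 2 : ℝ) • (E₂ + E₂') = e₂
  generalize (1 / 2 : ℝ) • (E₃ + E₃') = e₃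
  generalize (1 / 2 : ℝ) • (H₁ + H₁') = h₁
  generalize (1 / 2 : ℝ) • (H₂ + H₂') = h₂
  generalize (1 / 2 : ℝ) • (H₃ + H₃') = h₃
  simp only [dotProduct_add, dotProduct_sub, dotProduct_smul, smul_eq_mul]
  rw [dotProduct_mulVec_eq_neg_of_transpose_eq_neg hA₂ e₁ h₃,
    dotProduct_mulVec_eq_neg_of_transpose_eq_neg hA₃ e₁ h₂,
    dotProduct_mulVec_eq_neg_of_transpose_eq_neg hA₃ e₂ h₁,
    dotProduct_mulVec_eq_neg_of_transpose_eq_neg hA₁ e₂ h₃,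
    dotProduct_mulVec_eq_neg_of_transpose_eq_neg hA₁ e₃ h₂,
    dotProduct_mulVec_eq_neg_of_transpose_eq_neg hA₂ e₃ h₁,
    dotProduct_mul_left_comm e₁ h₁ W, dotProduct_mul_left_comm e₂ h₂ W, dotProduct_mul_left_comm e₃ h₃ W]
  ring
end

section
/- Let M, K₁, K₂, K₃ be skew-symmetric real 6×6 matrices, let C be a symmetric real 6×6 matrix, let Bˣ, Bʸ, Bᶻ be real matrices of sizes N₁×N₁, N₂×N₂, N₃×N₃ respectively, let Δt ≠ 0, and let real numbers ΔWᵢ be given for i = 1,…,N₁. Suppose the grid functions ξⁿ, ξⁿ⁺¹, ηⁿ, ηⁿ⁺¹ : {1,…,N₁}×{1,…,N₂}×{1,…,N₃} → ℝ⁶ both satisfy the discrete variational equation: for every (i,j,k), M (uⁿ⁺¹_{i,j,k} − uⁿ_{i,j,k})/Δt + Σ_{i'=1}^{N₁} (Bˣ)_{i,i'} K₁ u^{n+1/2}_{i',j,k} + Σ_{j'=1}^{N₂} (Bʸ)_{j,j'} K₂ u^{n+1/2}_{i,j',k} + Σ_{k'=1}^{N₃} (Bᶻ)_{k,k'} K₃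 u^{n+1/2}_{i,j,k'} = (ΔWᵢ/Δt) C u^{n+1/2}_{i,j,k}, where u^{n+1/2} = (uⁿ + uⁿ⁺¹)/2 and u stands for ξ and for η. Define ωⁿ_{i,j,k} = ⟨M ξⁿ_{i,j,k}, ηⁿ_{i,j,k}⟩, and for the midpoint values define (κₓ)_{i',i,j,k} = ⟨K₁ ξ^{n+1/2}_{i',j,k}, η^{n+1/2}_{i,j,k}⟩ − ⟨K₁ η^{n+1/2}_{i',j,k}, ξ^{n+1/2}_{i,j,k}⟩, and analogously (κ_y)_{j',i,j,k} with K₂ and the second index, and (κ_z)_{k',i,j,k} with K₃ and the third index. Then for every (i,j,k): (ωⁿ⁺¹_{i,j,k} − ωⁿ_{i,j,k})/Δt + Σ_{i'=1}^{N₁} (Bˣ)_{i,i'} (κₓ)_{i',i,j,k} + Σ_{j'=1}^{N₂} (Bʸ)_{j,j'} (κ_y)_{j',i,j,k} + Σ_{k'=1}^{N₃} (Bᶻ)_{k,k'} (κ_z)_{k',i,j,k} = 0. -/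
open Matrix

section BilinearForm

variable {n R : Type*} [Fintype n] [CommRing R]

theorem mulVec_dotProduct_eq_transpose_mulVec_dotProduct (A : Matrix n n R) (v w : n → R) :
    A *ᵥ v ⬝ᵥ w = Aᵀ *ᵥ w ⬝ᵥ v := by
  rw [dotProduct_comm, dotProduct_mulVec, mulVec_transpose]

theorem mulVec_dotProduct_comm_of_transpose_eq {A : Matrix n n R} (hA : Aᵀ = A) (v w : n → R) :
    A *ᵥ v ⬝ᵥ w = A *ᵥ w ⬝ᵥ v := by
  rw [mulVec_dotProduct_eq_transpose_mulVec_dotProduct, hA]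

theorem mulVec_dotProduct_comm_of_transpose_eq_neg {A : Matrix n n R} (hA : Aᵀ = -A)
    (v w : n → R) : A *ᵥ v ⬝ᵥ w = -(A *ᵥ w ⬝ᵥ v) := by
  rw [mulVec_dotProduct_eq_transpose_mulVec_dotProduct, hA, neg_mulVec, neg_dotProduct]

end BilinearForm

/-- The midpoint rule telescopes the increment of a skew-symmetric bilinear form. -/
theorem mulVec_sub_dotProduct_midpoint_sub {n : Type*} [Fintype n] {A : Matrix n n ℝ}
    (hA : Aᵀ = -A) (v v' w w' : n → ℝ) :
    A *ᵥ (v' - v) ⬝ᵥ ((1 / 2 : ℝ) • (w + w')) - A *ᵥ (w' - w) ⬝ᵥ ((1 / 2 : ℝ) • (v + v'))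
      = A *ᵥ v' ⬝ᵥ w' - A *ᵥ v ⬝ᵥ w := by
  rw [mulVec_dotProduct_comm_of_transpose_eq_neg hA (w' - w)]
  simp only [mulVec_sub, mulVec_smul, mulVec_add, sub_dotProduct, add_dotProduct, smul_dotProduct,
    dotProduct_sub, dotProduct_add, dotProduct_smul, smul_eq_mul]
  ring

/-- **Discrete stochastic multi-symplectic conservation law.**
If two grid functions `ξ, η` (with values at time levels `n` and `n+1`) both
satisfy the discrete variational equation of the stochastic multi-symplectic
wavelet collocation scheme (skew-symmetric `M, K₁, K₂, K₃`, symmetric Hessian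
`C`, differentiation matrices `Bx, By, Bz`), then the discrete density
`ω = ⟨Mξ, η⟩` and the fluxes `κₓ, κ_y, κ_z` satisfy the discrete conservation
law at every grid point. -/
theorem discrete_multisymplectic_conservation
    (N₁ N₂ N₃ : ℕ)
    (M K₁ K₂ K₃ C : Matrix (Fin 6) (Fin 6) ℝ)
    (hM : Mᵀ = -M) (hK₁ : K₁ᵀ = -K₁) (hK₂ : K₂ᵀ = -K₂) (hK₃ : K₃ᵀ = -K₃)
    (hC : Cᵀ = C)
    (Bx : Matrix (Fin N₁) (Fin N₁) ℝ) (By : Matrix (Fin N₂) (Fin N₂) ℝ)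
    (Bz : Matrix (Fin N₃) (Fin N₃) ℝ)
    (Δt : ℝ) (hΔt : Δt ≠ 0) (ΔW : Fin N₁ → ℝ)
    (ξ ξ' η η' : Fin N₁ → Fin N₂ → Fin N₃ → (Fin 6 → ℝ))
    (hξ : ∀ (i : Fin N₁) (j : Fin N₂) (k : Fin N₃),
      (1 / Δt) • M.mulVec (ξ' i j k - ξ i j k)
        + (∑ i' : Fin N₁, Bx i i' • K₁.mulVec ((1 / 2 : ℝ) • (ξ i' j k + ξ' i' j k)))
        + (∑ j' : Fin N₂, By j j' • K₂.mulVec ((1 / 2 : ℝ) • (ξ i j' k + ξ' i j' k)))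
        + (∑ k' : Fin N₃, Bz k k' • K₃.mulVec ((1 / 2 : ℝ) • (ξ i j k' + ξ' i j k')))
        = (ΔW i / Δt) • C.mulVec ((1 / 2 : ℝ) • (ξ i j k + ξ' i j k)))
    (hη : ∀ (i : Fin N₁) (j : Fin N₂) (k : Fin N₃),
      (1 / Δt) • M.mulVec (η' i j k - η i j k)
        + (∑ i' : Fin N₁, Bx i i' • K₁.mulVec ((1 / 2 : ℝ) • (η i' j k + η' i' j k)))
        + (∑ j' : Fin N₂, By j j' • K₂.mulVec ((1 / 2 : ℝ) • (η i j' k + η' i j' k)))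
        + (∑ k' : Fin N₃, Bz k k' • K₃.mulVec ((1 / 2 : ℝ) • (η i j k' + η' i j k')))
        = (ΔW i / Δt) • C.mulVec ((1 / 2 : ℝ) • (η i j k + η' i j k))) :
    ∀ (i : Fin N₁) (j : Fin N₂) (k : Fin N₃),
      (M.mulVec (ξ' i j k) ⬝ᵥ η' i j k - M.mulVec (ξ i j k) ⬝ᵥ η i j k) / Δt
        + (∑ i' : Fin N₁, Bx i i' *
            (K₁.mulVec ((1 / 2 : ℝ) • (ξ i' j k + ξ' i' j k))
                ⬝ᵥ ((1 / 2 : ℝ) • (η i j k + η' i j k))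
              - K₁.mulVec ((1 / 2 : ℝ) • (η i' j k + η' i' j k))
                ⬝ᵥ ((1 / 2 : ℝ) • (ξ i j k + ξ' i j k))))
        + (∑ j' : Fin N₂, By j j' *
            (K₂.mulVec ((1 / 2 : ℝ) • (ξ i j' k + ξ' i j' k))
                ⬝ᵥ ((1 / 2 : ℝ) • (η i j k + η' i j k))
              - K₂.mulVec ((1 / 2 : ℝ) • (η i j' k + η' i j' k))
                ⬝ᵥ ((1 / 2 : ℝ) • (ξ i j k + ξ' i j k))))
        + (∑ k' : Fin N₃, Bz k k' *
            (K₃.mulVec ((1 / 2 : ℝ) • (ξ i j k' + ξ' i j k'))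
                ⬝ᵥ ((1 / 2 : ℝ) • (η i j k + η' i j k))
              - K₃.mulVec ((1 / 2 : ℝ) • (η i j k' + η' i j k'))
                ⬝ᵥ ((1 / 2 : ℝ) • (ξ i j k + ξ' i j k))))
        = 0 := by
  intro i j k
  have eξ := congrArg (· ⬝ᵥ ((1 / 2 : ℝ) • (η i j k + η' i j k))) (hξ i j k)
  have eη := congrArg (· ⬝ᵥ ((1 / 2 : ℝ) • (ξ i j k + ξ' i j k))) (hη i j k)
  simp only [add_dotProduct _ _ ((1 / 2 : ℝ) • _), sum_dotProduct, smul_dotProduct _ (_ *ᵥ _),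
    smul_eq_mul] at eξ eη
  rw [mulVec_dotProduct_comm_of_transpose_eq hC] at eξ
  rw [← mulVec_sub_dotProduct_midpoint_sub hM]
  simp only [mul_sub, Finset.sum_sub_distrib]
  linear_combination eξ - eη
end
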